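/- There is no sequence ⟨f_α : α < ω₃⟩ of functions f_α : ω₂ → ω₂ such that for all α < β < ω₃ the function f_α is strictly below f_β modulo finite, i.e., the set {ν < ω₂ : f_α(ν) ≥ f_β(ν)} is finite. -/

import Mathlib

open Cardinal

universe u v

/-- A family of fewer than `c` ordinals below `c.ord` is strictly bounded below `c.ord`,
for regular `c`. -/
theorem exists_strict_bound {ι : Type v} {c : Cardinal.{u}} (hc : c.IsRegular)
    (hι : lift.{u} #ι < lift.{v} c) (g : ι → Ordinal.{u}) (hg : ∀ i, g i < c.ord) :
    ∃ b < c.ord, ∀ i, g i < b := by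
  have hcof : lift.{u} #ι < (Ordinal.lift.{v} c.ord).cof := by
    rwa [← Ordinal.lift_cof, hc.cof_ord]
  refine ⟨⨆ i, g i + 1, Ordinal.lift_iSup_add_one_lt_of_lt_cof hcof hg, fun i ↦ ?_⟩
  have hbdd : BddAbove (Set.range fun i ↦ g i + 1) := by
    refine ⟨c.ord, ?_⟩
    rintro _ ⟨j, rfl⟩
    exact Order.add_one_le_of_lt (hg j)
  exact (Order.lt_add_one_iff.2 le_rfl).trans_le (le_ciSup hbdd i)

theorem exists_strict_bound_of_countable {ι : Type v} [Countable ι] {c : Cardinal.{u}}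
    (hc : c.IsRegular) (hc₀ : ℵ₀ < c) (g : ι → Ordinal.{u}) (hg : ∀ i, g i < c.ord) :
    ∃ b < c.ord, ∀ i, g i < b := by
  refine exists_strict_bound hc ?_ g hg
  calc lift.{u} #ι ≤ ℵ₀ := by simp
    _ = lift.{v} ℵ₀ := by simp
    _ < lift.{v} c := lift_lt.2 hc₀

theorem isRegular_aleph_two : (aleph.{u} 2).IsRegular := by
  have h := isRegular_aleph_add_one.{u} 1
  rwa [one_add_one_eq_two] at h

theorem isRegular_aleph_three : (aleph.{u} 3).IsRegular := by
  have h := isRegular_aleph_add_one.{u} 2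
  rwa [two_add_one_eq_three] at h

theorem aleph_one_lt_aleph_two : aleph.{u} 1 < aleph 2 :=
  aleph_lt_aleph.2 (by exact_mod_cast Nat.lt_succ_self 1)

theorem aleph_two_lt_aleph_three : aleph.{u} 2 < aleph 3 :=
  aleph_lt_aleph.2 (by exact_mod_cast Nat.lt_succ_self 2)

theorem le_aleph_one_of_lt_aleph_two {c : Cardinal.{u}} (h : c < aleph 2) : c ≤ aleph 1 := by
  rwa [← one_add_one_eq_two, ← succ_aleph, Order.lt_succ_iff] at h

/-- There are `ℵ₂` many countable subsets of `ω₂` such that every sequence in `ω₂` takes its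
values in one of them. -/
theorem exists_countable_cover :
    ∃ S : Set.Iio (aleph.{u} 2).ord × Set.Iio (aleph.{u} 1).ord → Set Ordinal.{u},
      (∀ p, (S p).Countable) ∧
      ∀ g : ℕ → Ordinal.{u}, (∀ n, g n < (aleph 2).ord) → ∃ p, ∀ n, g n ∈ S p := by
  have emb : ∀ γ : Set.Iio (aleph.{u} 2).ord,
      Nonempty (Set.Iio γ.1 ↪ Set.Iio (aleph.{u} 1).ord) := by
    intro γ
    rw [← Cardinal.le_def, mk_Iio_ordinal, mk_Iio_ordinal, lift_le, card_ord]
    exact le_aleph_one_of_lt_aleph_two (lt_ord.1 γ.2)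
  have e : ∀ γ : Set.Iio (aleph.{u} 2).ord, Set.Iio γ.1 ↪ Set.Iio (aleph.{u} 1).ord :=
    fun γ ↦ (emb γ).some
  refine ⟨fun p ↦ Set.image Subtype.val {x : Set.Iio p.1.1 | e p.1 x < p.2}, fun p ↦ ?_,
    fun g hg ↦ ?_⟩
  · have hcount : (Set.Iio p.2.1).Countable := by
      rw [← le_aleph0_iff_set_countable, mk_Iio_ordinal, lift_le_aleph0, ← Order.lt_succ_iff,
        succ_aleph0]
      exact lt_ord.1 p.2.2
    exact (hcount.preimage_of_injOn
      (Subtype.val_injective.comp (e p.1).injective).injOn).image _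
  · obtain ⟨γ, hγ, hgγ⟩ := exists_strict_bound_of_countable isRegular_aleph_two
      (aleph0_lt_aleph_one.trans aleph_one_lt_aleph_two) g hg
    obtain ⟨ε, hε, heε⟩ := exists_strict_bound_of_countable isRegular_aleph_one
      aleph0_lt_aleph_one (fun n ↦ (e ⟨γ, hγ⟩ ⟨g n, hgγ n⟩).1) fun n ↦ (e _ _).2
    exact ⟨(⟨γ, hγ⟩, ⟨ε, hε⟩), fun n ↦ ⟨⟨g n, hgγ n⟩, heε n, rfl⟩⟩

theorem lift_mk_cover_index_lt :
    lift.{v} #(Set.Iio (aleph.{u} 2).ord × Set.Iio (aleph.{u} 1).ord) <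
      lift.{u + 1} (aleph.{v} 3) := by
  have h₂ : aleph.{max (u + 1) v} 2 < aleph 3 := aleph_two_lt_aleph_three
  have h₁ : aleph.{max (u + 1) v} 1 < aleph 3 := aleph_one_lt_aleph_two.trans h₂
  simpa using mul_lt_of_lt (aleph0_le_aleph 3) h₂ h₁

/-- A partition of `ω₃` into at most `ℵ₂` pieces has an unbounded piece. -/
theorem exists_unbounded_fiber {P : Type v} (hP : lift.{u} #P < lift.{v} (aleph.{u} 3))
    (c : Ordinal.{u} → P) :
    ∃ p, ∀ a < (aleph.{u} 3).ord, ∃ b, a < b ∧ b < (aleph.{u} 3).ord ∧ c b = p := by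
  by_contra! h
  choose a ha hab using h
  obtain ⟨b, hb, hlt⟩ := exists_strict_bound isRegular_aleph_three hP a ha
  exact hab (c b) b (hlt _) hb rfl

/-- The least sequence of ordinals whose `j`-th term exceeds `next` of all earlier terms. -/
noncomputable def closureSeq (next : Ordinal.{u} → Ordinal.{u}) (j : Ordinal.{u}) :
    Ordinal.{u} :=
  sInf {b | ∀ k, (_ : k < j) → next (closureSeq next k) < b}
termination_by j

theorem closureSeq_spec {next : Ordinal.{u} → Ordinal.{u}}
    (hnext : ∀ a < (aleph.{u} 3).ord, next a < (aleph 3).ord)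
    (j : Ordinal.{u}) (hj : j < (aleph 1).ord) :
    closureSeq next j < (aleph 3).ord ∧
      ∀ k < j, next (closureSeq next k) < closureSeq next j := by
  induction j using WellFoundedLT.induction with
  | ind j ih =>
    have hcard : lift.{u} #(Set.Iio j) < lift.{u + 1} (aleph.{u} 3) := by
      rw [mk_Iio_ordinal, lift_lift, lift_lt]
      exact (lt_ord.1 hj).trans (aleph_one_lt_aleph_two.trans aleph_two_lt_aleph_three)
    obtain ⟨b, hb, hlt⟩ := exists_strict_bound isRegular_aleph_three hcard
      (fun k ↦ next (closureSeq next k)) fun k ↦ hnext _ (ih k k.2 (k.2.trans hj)).1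
    have hmem : b ∈ {b | ∀ k, (_ : k < j) → next (closureSeq next k) < b} :=
      fun k hk ↦ hlt ⟨k, hk⟩
    rw [closureSeq]
    exact ⟨(csInf_le' hmem).trans_lt hb, csInf_mem ⟨b, hmem⟩⟩

/-- Shelah: there is no ω₃-sequence of functions from ω₂ to ω₂ which is strictly
increasing modulo finite. -/
theorem no_strong_chain_omega3 :
    ¬ ∃ f : Ordinal → Ordinal → Ordinal,
      (∀ α < (aleph 3).ord, ∀ ν < (aleph 2).ord, f α ν < (aleph 2).ord) ∧
      (∀ α β : Ordinal, α < β → β < (aleph 3).ord →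
        {ν : Ordinal | ν < (aleph 2).ord ∧ f β ν ≤ f α ν}.Finite) := by
  rintro ⟨f, hf, hfin⟩
  obtain ⟨S, hS, hcover⟩ := exists_countable_cover
  have hadd (i) (hi : i < (aleph 2).ord) (n : ℕ) : i + n < (aleph 2).ord :=
    (isSuccLimit_ord (aleph0_le_aleph 2)).add_natCast_lt hi n
  -- On each block `[i, i + ω)`, unboundedly many `f α` take values in a fixed countable set.
  have hblock : ∀ i : Set.Iio (aleph 2).ord, ∃ p, ∀ a < (aleph 3).ord,
      ∃ b, a < b ∧ b < (aleph 3).ord ∧ ∀ n : ℕ, f b (i + n) ∈ S p := by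
    intro i
    have hp : ∀ b, ∃ p, b < (aleph 3).ord → ∀ n : ℕ, f b (i + n) ∈ S p := by
      intro b
      by_cases hb : b < (aleph 3).ord
      · obtain ⟨p, hp⟩ := hcover (fun n ↦ f b (i + n)) fun n ↦ hf b hb _ (hadd i i.2 n)
        exact ⟨p, fun _ ↦ hp⟩
      · obtain ⟨p, -⟩ := hcover 0 fun n ↦ (isSuccLimit_ord (aleph0_le_aleph 2)).bot_lt
        exact ⟨p, fun h ↦ absurd h hb⟩
    choose c hc using hp
    obtain ⟨p, hp⟩ := exists_unbounded_fiber lift_mk_cover_index_lt c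
    refine ⟨p, fun a ha ↦ ?_⟩
    obtain ⟨b, hab, hb, rfl⟩ := hp a ha
    exact ⟨b, hab, hb, hc b hb⟩
  choose p hp using hblock
  -- Between `a` and `next a` every block sees one of these functions.
  have hnext : ∀ a, ∃ b, a < (aleph 3).ord → b < (aleph 3).ord ∧ ∀ i : Set.Iio (aleph 2).ord,
      ∃ β, a < β ∧ β < b ∧ ∀ n : ℕ, f β (i + n) ∈ S (p i) := by
    intro a
    by_cases ha : a < (aleph 3).ord
    · choose β haβ hβ hβS using fun i ↦ hp i a ha
      obtain ⟨b, hb, hβb⟩ := exists_strict_bound isRegular_aleph_three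
        (by simpa using aleph_two_lt_aleph_three) β hβ
      exact ⟨b, fun _ ↦ ⟨hb, fun i ↦ ⟨β i, haβ i, hβb i, hβS i⟩⟩⟩
    · exact ⟨0, fun h ↦ absurd h ha⟩
  choose next hnext using hnext
  have hseq := closureSeq_spec fun a ha ↦ (hnext a ha).1
  set α := closureSeq next
  have hlt (j k) (hk : k < (aleph 1).ord) (hjk : j < k) : α j < α k := by
    obtain ⟨β, h₁, h₂, -⟩ := (hnext (α j) (hseq j (hjk.trans hk)).1).2
      ⟨0, (isSuccLimit_ord (aleph0_le_aleph 2)).bot_lt⟩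
    exact h₁.trans (h₂.trans ((hseq k hk).2 j hjk))
  -- Beyond some `i < ω₂` the functions `f (α j)`, `j < ω₁`, increase at every coordinate.
  obtain ⟨i, hi, hmono⟩ : ∃ i < (aleph 2).ord, ∀ j k, k < (aleph 1).ord → j < k →
      ∀ ν, i ≤ ν → ν < (aleph 2).ord → f (α j) ν < f (α k) ν := by
    have hbad : ∀ q : Set.Iio (aleph 1).ord × Set.Iio (aleph 1).ord,
        ∃ b < (aleph 2).ord, q.1 < q.2 → ∀ ν, b ≤ ν → ν < (aleph 2).ord →
          f (α q.1) ν < f (α q.2) ν := by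
      intro q
      by_cases hq : q.1 < q.2
      · have := (hfin _ _ (hlt _ _ q.2.2 hq) (hseq _ q.2.2).1).to_subtype
        obtain ⟨b, hb, hνb⟩ := exists_strict_bound_of_countable isRegular_aleph_two
          (aleph0_lt_aleph_one.trans aleph_one_lt_aleph_two)
          (fun ν : {ν | ν < (aleph 2).ord ∧ f (α q.2) ν ≤ f (α q.1) ν} ↦ ν.1) fun ν ↦ ν.2.1
        refine ⟨b, hb, fun _ ν hbν hν ↦ ?_⟩
        by_contra! h
        exact (hνb ⟨ν, hν, h⟩).not_ge hbν
      · exact ⟨0, (isSuccLimit_ord (aleph0_le_aleph 2)).bot_lt, fun h ↦ absurd h hq⟩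
    choose b hb hbf using hbad
    obtain ⟨i, hi, hbi⟩ := exists_strict_bound isRegular_aleph_two
      (by simp) b hb
    exact ⟨i, hi, fun j k hk hjk ν hν ↦
      hbf (⟨j, hjk.trans hk⟩, ⟨k, hk⟩) hjk ν ((hbi _).le.trans hν)⟩
  -- From some `j₀ < ω₁` on, these functions cross no further points of the countable set.
  obtain ⟨j₀, hj₀, hstab⟩ : ∃ j₀ < (aleph 1).ord, ∀ n : ℕ, ∀ s ∈ S (p ⟨i, hi⟩),
      ∀ k < (aleph 1).ord, s < f (α k) (i + n) → s < f (α j₀) (i + n) := by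
    have hcross : ∀ q : ℕ × S (p ⟨i, hi⟩), ∃ j < (aleph 1).ord, ∀ k < (aleph 1).ord,
        q.2.1 < f (α k) (i + q.1) → q.2.1 < f (α j) (i + q.1) := by
      intro q
      by_cases h : ∃ j < (aleph 1).ord, q.2.1 < f (α j) (i + q.1)
      · obtain ⟨j, hj, hjq⟩ := h
        exact ⟨j, hj, fun _ _ _ ↦ hjq⟩
      · push Not at h
        exact ⟨0, (isSuccLimit_ord (aleph0_le_aleph 1)).bot_lt,
          fun k hk hkq ↦ absurd hkq (h k hk).not_gt⟩
    choose j hj hjq using hcross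
    have := (hS (p ⟨i, hi⟩)).to_subtype
    obtain ⟨j₀, hj₀, hjj₀⟩ := exists_strict_bound_of_countable isRegular_aleph_one
      aleph0_lt_aleph_one j hj
    exact ⟨j₀, hj₀, fun n s hs k hk hsk ↦ (hjq (n, ⟨s, hs⟩) k hk hsk).trans
      (hmono _ _ hj₀ (hjj₀ _) _ le_self_add (hadd i hi n))⟩
  have hj₁ : j₀ + 1 < (aleph 1).ord := (isSuccLimit_ord (aleph0_le_aleph 1)).add_one_lt hj₀
  obtain ⟨β, hβ₀, hβ₁, hβS⟩ := (hnext (α j₀) (hseq j₀ hj₀).1).2 ⟨i, hi⟩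
  replace hβ₁ : β < α (j₀ + 1) := hβ₁.trans ((hseq _ hj₁).2 j₀ (Order.lt_add_one_iff.2 le_rfl))
  have hfinite := (hfin _ _ hβ₀ (hβ₁.trans (hseq _ hj₁).1)).union (hfin _ _ hβ₁ (hseq _ hj₁).1)
  have hinj : Function.Injective fun n : ℕ ↦ i + n := fun m n h ↦ by simpa using h
  obtain ⟨n, hn⟩ := (hfinite.preimage hinj.injOn).infinite_compl.nonempty
  simp only [Set.mem_compl_iff, Set.mem_preimage, Set.mem_union, Set.mem_ofPred_eq,
    hadd i hi n, true_and, not_or, not_le] at hn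
  exact (hstab n _ (hβS n) _ hj₁ hn.2).not_gt hn.1
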